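/- (Natural gradient descent keeps stabilizing and decreases the value matrix.) Let K₀ ∈ S and define iterates K_{j+1} = K_j − 2 η_j M(K_j) with stepsizes satisfying 0 < η_j ≤ 1 / λ_n( R + Bᵀ X(K₀) B ). Then every K_j is Schur-stabilizing, X(K_{j+1}) ⪯ X(K_j) for every j, and Z := X(K_{j+1}) − X(K_j) solves the Lyapunov equation (A − B K_{j+1})ᵀ Z (A − B K_{j+1}) − Z + M_jᵀ ( −4 η_j I + 4 η_j² ( R + Bᵀ X(K_j) B ) ) M_j = 0, where M_j = M(K_j). -/

import Mathlib

open Matrix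

/-- `M` is Schur stable: spectral radius `ρ(M) < 1`. -/
def IsSchur {k : ℕ} (M : Matrix (Fin k) (Fin k) ℝ) : Prop :=
  ∀ μ ∈ spectrum ℂ (M.map (Complex.ofReal ·)), ‖μ‖ < 1

/-- The largest eigenvalue `λ_n` of a (symmetric) real matrix. -/
noncomputable def eigMax {k : ℕ} (M : Matrix (Fin k) (Fin k) ℝ) : ℝ :=
  sSup (spectrum ℝ M)

open Filter Topology in
/-- In a complex Banach algebra, the powers of an element of spectral radius less than one
tend to zero. -/
theorem tendsto_pow_zero_of_spectralRadius_lt_one {𝔸 : Type*} [NormedRing 𝔸]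
    [NormedAlgebra ℂ 𝔸] [CompleteSpace 𝔸] {a : 𝔸} (ha : spectralRadius ℂ a < 1) :
    Tendsto (fun k : ℕ => a ^ k) atTop (𝓝 0) := by
  obtain ⟨r, har, hr1⟩ := ENNReal.lt_iff_exists_nnreal_btwn.mp ha
  have hr1' : r < 1 := by exact_mod_cast hr1
  have hlt := (spectrum.pow_nnnorm_pow_one_div_tendsto_nhds_spectralRadius a).eventually_lt_const har
  refine squeeze_zero_norm' ?_
    (tendsto_pow_atTop_nhds_zero_of_lt_one r.coe_nonneg (by exact_mod_cast hr1'))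
  filter_upwards [hlt, eventually_gt_atTop 0] with k hk hk0
  have hk0' : (0 : ℝ) < k := by exact_mod_cast hk0
  have h := ENNReal.rpow_le_rpow hk.le hk0'.le
  rw [← ENNReal.rpow_mul, one_div_mul_cancel hk0'.ne', ENNReal.rpow_one,
    ENNReal.rpow_natCast] at h
  exact_mod_cast h

section

attribute [local instance] Matrix.linftyOpNormedRing Matrix.linftyOpNormedAlgebra

open Filter Topology in
theorem IsSchur.tendsto_pow {k : ℕ} (hk : 0 < k) {L : Matrix (Fin k) (Fin k) ℝ}
    (hL : IsSchur L) : Tendsto (fun p : ℕ => L ^ p) atTop (𝓝 0) := by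
  have : Nonempty (Fin k) := ⟨⟨0, hk⟩⟩
  have hrad : spectralRadius ℂ (L.map (Complex.ofReal ·)) < 1 := by
    refine spectrum.spectralRadius_lt_of_forall_lt (r := 1) _ fun z hz => ?_
    exact_mod_cast hL z hz
  have h := tendsto_pow_zero_of_spectralRadius_lt_one hrad
  have hre : Continuous fun M : Matrix (Fin k) (Fin k) ℂ => M.map Complex.re :=
    continuous_id.matrix_map Complex.continuous_re
  have h2 := (hre.tendsto 0).comp h
  have hpow (p : ℕ) : (L.map (Complex.ofReal ·) ^ p).map Complex.re = L ^ p := by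
    have : L.map (Complex.ofReal ·) ^ p = (L ^ p).map (Complex.ofReal ·) :=
      (map_pow Complex.ofRealHom.mapMatrix L p).symm
    rw [this]
    ext i j
    simp
  convert! h2 using 2
  exact (hpow _).symm

end

open Filter Topology in
/-- The quadratic congruences of a fixed matrix by powers of a Schur matrix tend to zero. -/
theorem IsSchur.tendsto_conj_pow {k : ℕ} (hk : 0 < k) {L : Matrix (Fin k) (Fin k) ℝ}
    (hL : IsSchur L) (Y : Matrix (Fin k) (Fin k) ℝ) :
    Tendsto (fun p : ℕ => (L ^ p)ᵀ * Y * L ^ p) atTop (𝓝 0) := by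
  have hc : Continuous fun M : Matrix (Fin k) (Fin k) ℝ => Mᵀ * Y * M := by fun_prop
  have h := (hc.tendsto 0).comp (hL.tendsto_pow hk)
  rwa [Matrix.mul_zero] at h

/-- The homogeneous discrete Lyapunov equation of a Schur matrix has only the zero solution. -/
theorem IsSchur.eq_zero_of_conj_eq {k : ℕ} (hk : 0 < k) {L Y : Matrix (Fin k) (Fin k) ℝ}
    (hL : IsSchur L) (hY : Lᵀ * Y * L = Y) : Y = 0 := by
  have hp (p : ℕ) : (L ^ p)ᵀ * Y * L ^ p = Y := by
    induction p with
    | zero => simp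
    | succ p ih =>
      rw [pow_succ, transpose_mul]
      calc Lᵀ * (L ^ p)ᵀ * Y * (L ^ p * L) = Lᵀ * ((L ^ p)ᵀ * Y * L ^ p) * L := by
            simp only [Matrix.mul_assoc]
        _ = Y := by rw [ih, hY]
  have h := hL.tendsto_conj_pow hk Y
  simp only [hp] at h
  exact tendsto_nhds_unique tendsto_const_nhds h

theorem IsSchur.isHermitian_of_lyapunov {k : ℕ} (hk : 0 < k)
    {L Y P : Matrix (Fin k) (Fin k) ℝ} (hL : IsSchur L) (hP : P.IsHermitian)
    (hY : Lᵀ * Y * L + P = Y) : Y.IsHermitian := by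
  have hP' : Pᵀ = P := by simpa using hP.eq
  have hYt : Lᵀ * Yᵀ * L + P = Yᵀ := by
    have := congrArg transpose hY
    simpa [hP', Matrix.mul_assoc] using this
  have h0 := hL.eq_zero_of_conj_eq hk (Y := Yᵀ - Y) (by
    rw [Matrix.mul_sub, Matrix.sub_mul]
    rw [eq_sub_of_add_eq hYt, eq_sub_of_add_eq hY]
    abel)
  rw [sub_eq_zero] at h0
  simpa [Matrix.IsHermitian] using h0

/-- The solution of a discrete Lyapunov equation with positive semidefinite forcing is positive
semidefinite. -/
theorem IsSchur.posSemidef_of_lyapunov {k : ℕ} (hk : 0 < k)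
    {L Y P : Matrix (Fin k) (Fin k) ℝ} (hL : IsSchur L) (hP : P.PosSemidef)
    (hY : Lᵀ * Y * L + P = Y) : Y.PosSemidef := by
  refine .of_dotProduct_mulVec_nonneg (hL.isHermitian_of_lyapunov hk hP.isHermitian hY)
    fun x => ?_
  have hp (p : ℕ) : (Y - (L ^ p)ᵀ * Y * L ^ p).PosSemidef := by
    induction p with
    | zero => simpa using Matrix.PosSemidef.zero
    | succ p ih =>
      have h := (ih.conjTranspose_mul_mul_same L).add hP
      rw [conjTranspose_eq_transpose_of_trivial] at h
      convert! h using 1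
      rw [pow_succ, transpose_mul, Matrix.mul_sub, Matrix.sub_mul]
      nth_rewrite 1 [← hY]
      simp only [Matrix.mul_assoc]
      abel
  have hc : Continuous fun M : Matrix (Fin k) (Fin k) ℝ => star x ⬝ᵥ ((Y - M) *ᵥ x) := by fun_prop
  have h := (hc.tendsto 0).comp (hL.tendsto_conj_pow hk Y)
  rw [sub_zero] at h
  exact ge_of_tendsto' h fun p => (hp p).dotProduct_mulVec_nonneg x

/-- Lyapunov's stability criterion. -/
theorem IsSchur.of_lyapunov {k : ℕ} {L Y P : Matrix (Fin k) (Fin k) ℝ} (hY : Y.PosSemidef)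
    (hP : P.PosDef) (h : Lᵀ * Y * L + P = Y) : IsSchur L := by
  intro μ hμ
  rw [← Matrix.spectrum_toLin', ← Module.End.hasEigenvalue_iff_mem_spectrum] at hμ
  obtain ⟨v, hv⟩ := hμ.exists_hasEigenvector
  have hev := hv.apply_eq_smul
  rw [Matrix.toLin'_apply] at hev
  set x : Fin k → ℝ := fun i => (v i).re with hx
  set y : Fin k → ℝ := fun i => (v i).im with hy
  have hLx : L *ᵥ x = μ.re • x - μ.im • y := by
    ext i
    simpa [Matrix.mulVec, dotProduct, hx, hy] using congrArg Complex.re (congrFun hev i)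
  have hLy : L *ᵥ y = μ.re • y + μ.im • x := by
    ext i
    simpa [Matrix.mulVec, dotProduct, hx, hy] using congrArg Complex.im (congrFun hev i)
  have hq (z : Fin k → ℝ) :
      (L *ᵥ z) ⬝ᵥ (Y *ᵥ (L *ᵥ z)) + z ⬝ᵥ (P *ᵥ z) = z ⬝ᵥ (Y *ᵥ z) := by
    conv_rhs => rw [← h]
    rw [Matrix.add_mulVec, dotProduct_add, ← Matrix.mulVec_mulVec, ← Matrix.mulVec_mulVec,
      Matrix.dotProduct_mulVec z Lᵀ, Matrix.vecMul_transpose]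
  have hqx := hq x
  have hqy := hq y
  rw [hLx] at hqx
  rw [hLy] at hqy
  simp only [Matrix.mulVec_add, Matrix.mulVec_sub, Matrix.mulVec_smul, dotProduct_add,
    dotProduct_sub, add_dotProduct, sub_dotProduct, smul_dotProduct, dotProduct_smul,
    smul_eq_mul] at hqx hqy
  have hYx : 0 ≤ x ⬝ᵥ (Y *ᵥ x) := by simpa using hY.dotProduct_mulVec_nonneg x
  have hYy : 0 ≤ y ⬝ᵥ (Y *ᵥ y) := by simpa using hY.dotProduct_mulVec_nonneg y
  have hPx : 0 ≤ x ⬝ᵥ (P *ᵥ x) := by simpa using hP.posSemidef.dotProduct_mulVec_nonneg x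
  have hPy : 0 ≤ y ⬝ᵥ (P *ᵥ y) := by simpa using hP.posSemidef.dotProduct_mulVec_nonneg y
  have hpos : 0 < x ⬝ᵥ (P *ᵥ x) + y ⬝ᵥ (P *ᵥ y) := by
    by_cases hx0 : x = 0
    · have hy0 : y ≠ 0 := by
        intro hy0
        refine hv.2 (funext fun i => Complex.ext ?_ ?_)
        · exact congrFun hx0 i
        · exact congrFun hy0 i
      have : 0 < y ⬝ᵥ (P *ᵥ y) := by simpa using hP.dotProduct_mulVec_pos hy0
      linarith
    · have : 0 < x ⬝ᵥ (P *ᵥ x) := by simpa using hP.dotProduct_mulVec_pos hx0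
      linarith
  have hnorm : ‖μ‖ ^ 2 = μ.re ^ 2 + μ.im ^ 2 := by
    rw [Complex.sq_norm, Complex.normSq_apply]
    ring
  by_contra! hge
  have h1 : 1 ≤ ‖μ‖ ^ 2 := one_le_pow₀ hge
  nlinarith [mul_nonneg (sub_nonneg.mpr h1) (add_nonneg hYx hYy)]

/-- A Hermitian real matrix is bounded above by its largest eigenvalue in the Loewner order. -/
theorem posSemidef_eigMax_smul_one_sub {k : ℕ} {G : Matrix (Fin k) (Fin k) ℝ}
    (hG : G.IsHermitian) : (eigMax G • (1 : Matrix (Fin k) (Fin k) ℝ) - G).PosSemidef := by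
  rw [← Algebra.algebraMap_eq_smul_one, Matrix.posSemidef_iff_isHermitian_and_spectrum_nonneg]
  constructor
  · rw [Algebra.algebraMap_eq_smul_one]
    exact (Matrix.isHermitian_one.smul (IsSelfAdjoint.all _)).sub hG
  · rw [← spectrum.singleton_sub_eq]
    rintro _ ⟨_, rfl, b, hb, rfl⟩
    have hfin : (spectrum ℝ G).Finite := by
      rw [hG.spectrum_real_eq_range_eigenvalues]
      exact Set.finite_range _
    exact sub_nonneg.mpr (le_csSup hfin.bddAbove hb)

/-- The cost identity for one natural gradient step. -/
theorem natural_gradient_step_identity {n m : ℕ} (A : Matrix (Fin n) (Fin n) ℝ)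
    (B : Matrix (Fin n) (Fin m) ℝ) (Q Y : Matrix (Fin n) (Fin n) ℝ)
    (R : Matrix (Fin m) (Fin m) ℝ) (K M : Matrix (Fin m) (Fin n) ℝ) (hR : Rᵀ = R) (hYt : Yᵀ = Y)
    (hY : (A - B * K)ᵀ * Y * (A - B * K) + Kᵀ * R * K + Q = Y)
    (hM : M = R * K - Bᵀ * Y * (A - B * K)) (η : ℝ) :
    (A - B * (K - (2 * η) • M))ᵀ * Y * (A - B * (K - (2 * η) • M))
      + ((K - (2 * η) • M)ᵀ * R * (K - (2 * η) • M) + Q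
        + Mᵀ * ((4 * η) • (1 : Matrix (Fin m) (Fin m) ℝ) - (4 * η ^ 2) • (R + Bᵀ * Y * B)) * M)
      = Y := by
  have hL : A - B * (K - (2 * η) • M) = (A - B * K) + (2 * η) • (B * M) := by
    rw [Matrix.mul_sub, Matrix.mul_smul]
    abel
  rw [hL]
  set L := A - B * K with hLdef
  have hMM : Mᵀ * M = Mᵀ * (R * K) - Mᵀ * (Bᵀ * (Y * L)) := by
    nth_rewrite 2 [hM]
    simp only [Matrix.mul_sub, Matrix.mul_assoc]
  have hMM' : Mᵀ * M = Kᵀ * (R * M) - Lᵀ * (Y * (B * M)) := by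
    nth_rewrite 1 [hM]
    simp only [transpose_sub, transpose_mul, transpose_transpose, hR, hYt, Matrix.sub_mul,
      Matrix.mul_assoc]
  have h1 : Mᵀ * (R * K) = Mᵀ * M + Mᵀ * (Bᵀ * (Y * L)) := by rw [hMM]; abel
  have h2 : Kᵀ * (R * M) = Mᵀ * M + Lᵀ * (Y * (B * M)) := by rw [hMM']; abel
  conv_rhs => rw [← hY]
  simp only [transpose_add, transpose_sub, transpose_smul, transpose_mul, Matrix.add_mul,
    Matrix.mul_add, Matrix.sub_mul, Matrix.mul_sub, Matrix.smul_mul, Matrix.mul_smul,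
    Matrix.mul_assoc, Matrix.one_mul, h1, h2]
  module

theorem posSemidef_step_weight {n m : ℕ} {B : Matrix (Fin n) (Fin m) ℝ}
    {R : Matrix (Fin m) (Fin m) ℝ} {X₀ Y : Matrix (Fin n) (Fin n) ℝ}
    (hG : (R + Bᵀ * X₀ * B).IsHermitian) (hY : (X₀ - Y).PosSemidef) {η : ℝ} (hη : 0 < η)
    (hle : η ≤ 1 / eigMax (R + Bᵀ * X₀ * B)) :
    ((4 * η) • (1 : Matrix (Fin m) (Fin m) ℝ) - (4 * η ^ 2) • (R + Bᵀ * Y * B)).PosSemidef := by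
  set e := eigMax (R + Bᵀ * X₀ * B) with he
  have hepos : 0 < e := one_div_pos.mp (hη.trans_le hle)
  have hηe : η * e ≤ 1 := (le_div_iff₀ hepos).mp hle
  have h1 : ((4 * η * (1 - η * e)) • (1 : Matrix (Fin m) (Fin m) ℝ)).PosSemidef :=
    Matrix.PosSemidef.one.smul (mul_nonneg (by positivity) (sub_nonneg.mpr hηe))
  have h2 := (posSemidef_eigMax_smul_one_sub hG).smul (show 0 ≤ 4 * η ^ 2 by positivity)
  have h3 := (hY.conjTranspose_mul_mul_same B).smul (show 0 ≤ 4 * η ^ 2 by positivity)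
  rw [conjTranspose_eq_transpose_of_trivial, Matrix.mul_sub, Matrix.sub_mul] at h3
  convert! (h1.add h2).add h3 using 1
  rw [← he]
  module

theorem stmt15 {n m : ℕ} (hn : 0 < n) (hm : 0 < m)
    (A : Matrix (Fin n) (Fin n) ℝ) (B : Matrix (Fin n) (Fin m) ℝ)
    (Q Sig : Matrix (Fin n) (Fin n) ℝ) (R : Matrix (Fin m) (Fin m) ℝ)
    (hQ : Q.PosDef) (hR : R.PosDef) (hSig : Sig.PosDef)
    (X : Matrix (Fin m) (Fin n) ℝ → Matrix (Fin n) (Fin n) ℝ)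
    (hX : ∀ K, IsSchur (A - B * K) →
      (A - B * K)ᵀ * X K * (A - B * K) + Kᵀ * R * K + Q = X K)
    -- the natural gradient descent iterates
    (K₀ : Matrix (Fin m) (Fin n) ℝ) (hK₀ : IsSchur (A - B * K₀))
    (Kseq : ℕ → Matrix (Fin m) (Fin n) ℝ) (hK0 : Kseq 0 = K₀)
    (Mseq : ℕ → Matrix (Fin m) (Fin n) ℝ)
    (hM : ∀ j, Mseq j = R * Kseq j - Bᵀ * X (Kseq j) * (A - B * Kseq j))
    (η : ℕ → ℝ) (hηpos : ∀ j, 0 < η j)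
    (hηle : ∀ j, η j ≤ 1 / eigMax (R + Bᵀ * X K₀ * B))
    (hrec : ∀ j, Kseq (j + 1) = Kseq j - (2 * η j) • Mseq j) :
    (∀ j, IsSchur (A - B * Kseq j)) ∧
    (∀ j, (X (Kseq j) - X (Kseq (j + 1))).PosSemidef) ∧
    ∀ j, (A - B * Kseq (j + 1))ᵀ * (X (Kseq (j + 1)) - X (Kseq j)) * (A - B * Kseq (j + 1))
        - (X (Kseq (j + 1)) - X (Kseq j))
        + (Mseq j)ᵀ * ((-(4 * η j)) • (1 : Matrix (Fin m) (Fin m) ℝ)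
            + (4 * η j ^ 2) • (R + Bᵀ * X (Kseq j) * B)) * Mseq j = 0 := by
  have hRt : Rᵀ = R := by simpa using hR.isHermitian.eq
  have hforce (K : Matrix (Fin m) (Fin n) ℝ) : (Kᵀ * R * K + Q).PosDef := by
    have h := hQ.posSemidef_add (hR.posSemidef.conjTranspose_mul_mul_same K)
    rwa [conjTranspose_eq_transpose_of_trivial] at h
  have hXpsd (K : Matrix (Fin m) (Fin n) ℝ) (hK : IsSchur (A - B * K)) : (X K).PosSemidef :=
    hK.posSemidef_of_lyapunov hn (hforce K).posSemidef (by rw [← add_assoc]; exact hX K hK)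
  have hG : (R + Bᵀ * X K₀ * B).IsHermitian := by
    have h := (hXpsd K₀ hK₀).conjTranspose_mul_mul_same B
    rw [conjTranspose_eq_transpose_of_trivial] at h
    exact hR.isHermitian.add h.isHermitian
  have hid (j : ℕ) (hj : IsSchur (A - B * Kseq j)) :=
    natural_gradient_step_identity A B Q (X (Kseq j)) R (Kseq j) (Mseq j) hRt
      (by simpa using (hXpsd _ hj).isHermitian.eq) (hX _ hj) (hM j) (η j)
  simp only [← hrec] at hid
  have hstep (j : ℕ) (hj : IsSchur (A - B * Kseq j)) (hle : (X K₀ - X (Kseq j)).PosSemidef) :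
      IsSchur (A - B * Kseq (j + 1)) ∧ (X (Kseq j) - X (Kseq (j + 1))).PosSemidef := by
    have hW := (posSemidef_step_weight hG hle (hηpos j) (hηle j)).conjTranspose_mul_mul_same
      (Mseq j)
    rw [conjTranspose_eq_transpose_of_trivial] at hW
    have hS : IsSchur (A - B * Kseq (j + 1)) :=
      .of_lyapunov (hXpsd _ hj) ((hforce _).add_posSemidef hW) (hid j hj)
    refine ⟨hS, hS.posSemidef_of_lyapunov hn hW ?_⟩
    have hX' := hX _ hS
    rw [add_assoc] at hX'
    rw [Matrix.mul_sub (A - B * Kseq (j + 1))ᵀ (X _), Matrix.sub_mul (_ * _),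
      eq_sub_of_add_eq (hid j hj), eq_sub_of_add_eq hX']
    abel
  have hall (j : ℕ) : IsSchur (A - B * Kseq j) ∧ (X K₀ - X (Kseq j)).PosSemidef := by
    induction j with
    | zero =>
      rw [hK0, sub_self]
      exact ⟨hK₀, Matrix.PosSemidef.zero⟩
    | succ j ih =>
      obtain ⟨hS, hd⟩ := hstep j ih.1 ih.2
      refine ⟨hS, ?_⟩
      convert! ih.2.add hd using 1
      abel
  refine ⟨fun j => (hall j).1, fun j => (hstep j (hall j).1 (hall j).2).2, fun j => ?_⟩
  have hX' := hX _ (hall (j + 1)).1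
  have hid' := hid j (hall j).1
  have hneg : (-(4 * η j)) • (1 : Matrix (Fin m) (Fin m) ℝ)
      + (4 * η j ^ 2) • (R + Bᵀ * X (Kseq j) * B)
      = -((4 * η j) • (1 : Matrix (Fin m) (Fin m) ℝ)
        - (4 * η j ^ 2) • (R + Bᵀ * X (Kseq j) * B)) := by
    module
  rw [hneg, Matrix.mul_neg, Matrix.neg_mul,
    Matrix.mul_sub (A - B * Kseq (j + 1))ᵀ (X _), Matrix.sub_mul (_ * _)]
  set W := (Mseq j)ᵀ * ((4 * η j) • (1 : Matrix (Fin m) (Fin m) ℝ)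
    - (4 * η j ^ 2) • (R + Bᵀ * X (Kseq j) * B)) * Mseq j
  rw [add_assoc] at hX'
  rw [eq_sub_of_add_eq hid', eq_sub_of_add_eq hX']
  abel
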